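/- For a 3-form T in dimension n ≥ 5, the square T² inside the Clifford algebra has no components of degree 2 and degree 6; its scalar part equals ||T||² = (1/6)Σ_{i,j}||T(e_i,e_j)||² and its degree-4 part equals −2σ_T, where σ_T = (1/2)Σ_k (e_k ⌟ T) ∧ (e_k ⌟ T). -/

import Mathlib

open CliffordAlgebra ExteriorAlgebra

/-- The negative definite quadratic form on ℝⁿ: basis vectors satisfy `eᵢ² = -1`. -/
noncomputable def QnegE (n : ℕ) : QuadraticForm ℝ (Fin n → ℝ) :=
  QuadraticMap.weightedSumSquares ℝ (fun _ : Fin n => (-1 : ℝ))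

namespace TriForm

variable {n : ℕ} {V : Type*} [AddCommGroup V] [Module ℝ V]

theorem eq_zero_of_self_eq_neg {x : V} (h : x = -x) : x = 0 := by
  have h2 : (2 : ℝ) • x = 0 := by
    rw [two_smul]
    nth_rewrite 1 [h]
    simp
  exact (smul_eq_zero.1 h2).resolve_left (by norm_num)

/-- Contraction of the coefficients with a family of vectors. -/
noncomputable def S (t : Fin n → Fin n → Fin n → ℝ) (f : Fin n → Fin n → Fin n → V) : V :=
  ∑ i, ∑ j, ∑ k, t i j k • f i j k

theorem S_sub (t : Fin n → Fin n → Fin n → ℝ) (f g : Fin n → Fin n → Fin n → V) :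
    S t (fun i j k => f i j k - g i j k) = S t f - S t g := by
  simp only [S, smul_sub, Finset.sum_sub_distrib]

theorem S_smul (t : Fin n → Fin n → Fin n → ℝ) (r : ℝ) (f : Fin n → Fin n → Fin n → V) :
    S t (fun i j k => r • f i j k) = r • S t f := by
  simp only [S, Finset.smul_sum, smul_comm r]

theorem map_S {W : Type*} [AddCommGroup W] [Module ℝ W] (φ : V →ₗ[ℝ] W)
    (t : Fin n → Fin n → Fin n → ℝ) (f : Fin n → Fin n → Fin n → V) :
    φ (S t f) = S t (fun i j k => φ (f i j k)) := by
  simp only [S, map_sum, map_smul]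

theorem S_swap12 {t : Fin n → Fin n → Fin n → ℝ} (h : ∀ i j k, t i j k = - t j i k)
    (f : Fin n → Fin n → Fin n → V) : S t (fun i j k => f j i k) = - S t f := by
  simp only [S]
  rw [Finset.sum_comm, ← Finset.sum_neg_distrib]
  refine Finset.sum_congr rfl fun i _ => ?_
  rw [← Finset.sum_neg_distrib]
  refine Finset.sum_congr rfl fun j _ => ?_
  rw [← Finset.sum_neg_distrib]
  refine Finset.sum_congr rfl fun k _ => ?_
  rw [h j i k, neg_smul]

theorem S_swap23 {t : Fin n → Fin n → Fin n → ℝ} (h : ∀ i j k, t i j k = - t i k j)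
    (f : Fin n → Fin n → Fin n → V) : S t (fun i j k => f i k j) = - S t f := by
  simp only [S]
  rw [← Finset.sum_neg_distrib]
  refine Finset.sum_congr rfl fun i _ => ?_
  rw [Finset.sum_comm, ← Finset.sum_neg_distrib]
  refine Finset.sum_congr rfl fun j _ => ?_
  rw [← Finset.sum_neg_distrib]
  refine Finset.sum_congr rfl fun k _ => ?_
  rw [h i k j, neg_smul]

/-- Kronecker delta. -/
def dl (i j : Fin n) : ℝ := if i = j then 1 else 0

theorem dl_comm (i j : Fin n) : dl i j = dl j i := by
  simp only [dl, eq_comm]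

theorem S_d12 {t : Fin n → Fin n → Fin n → ℝ} (h : ∀ i j k, t i j k = - t j i k)
    (f : Fin n → V) : S t (fun i j k => dl i j • f k) = 0 := by
  have := S_swap12 h (fun i j k => dl i j • f k)
  have h2 : S t (fun i j k => dl j i • f k) = S t (fun i j k => dl i j • f k) := by
    congr 1; funext i j k; rw [dl_comm]
  rw [h2] at this
  exact eq_zero_of_self_eq_neg this

theorem S_d23 {t : Fin n → Fin n → Fin n → ℝ} (h : ∀ i j k, t i j k = - t i k j)
    (f : Fin n → V) : S t (fun i j k => dl j k • f i) = 0 := by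
  have h1 := S_swap23 h (fun i j k => dl j k • f i)
  have h2 : S t (fun i j k => dl k j • f i) = S t (fun i j k => dl j k • f i) := by
    congr 1; funext i j k; rw [dl_comm]
  rw [h2] at h1
  exact eq_zero_of_self_eq_neg h1

variable {t : Fin n → Fin n → Fin n → ℝ}
  (h1 : ∀ i j k, t i j k = - t j i k) (h2 : ∀ i j k, t i j k = - t i k j)
  (E D : Fin n → V →ₗ[ℝ] V)
  (hDE : ∀ i j x, D i (E j x) = dl i j • x - E j (D i x))

include h1 h2 hDE

theorem S_LLL (x : V) :
    S t (fun i j k => (E i - D i) ((E j - D j) ((E k - D k) x))) =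
      S t (fun i j k => E i (E j (E k x))) - (3 : ℝ) • S t (fun i j k => E i (E j (D k x)))
      + (3 : ℝ) • S t (fun i j k => E i (D j (D k x))) - S t (fun i j k => D i (D j (D k x))) := by
  have a1 : S t (fun i j k => E i (D j (E k x))) = S t (fun i j k => E i (E j (D k x))) := by
    simp only [hDE, map_sub, map_smul]
    rw [S_sub, S_d23 h2 (fun i => E i x), S_swap23 h2 (fun i j k => E i (E j (D k x)))]
    simp
  have a2 : S t (fun i j k => D i (E j (E k x))) = S t (fun i j k => E i (D j (E k x))) := by
    have : (fun i j k => D i (E j (E k x))) =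
        fun i j k => dl i j • E k x - E j (D i (E k x)) := by
      funext i j k; rw [hDE i j]
    rw [this, S_sub, S_d12 h1 (fun i => E i x), S_swap12 h1 (fun i j k => E i (D j (E k x)))]
    simp
  have a3 : S t (fun i j k => D i (E j (D k x))) = S t (fun i j k => E i (D j (D k x))) := by
    simp only [hDE]
    rw [S_sub, S_d12 h1 (fun i => D i x), S_swap12 h1 (fun i j k => E i (D j (D k x)))]
    simp
  have a4 : S t (fun i j k => D i (D j (E k x))) = S t (fun i j k => D i (E j (D k x))) := by
    have : (fun i j k => D i (D j (E k x))) =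
        fun i j k => dl j k • D i x - D i (E k (D j x)) := by
      funext i j k; rw [hDE j k, map_sub, map_smul]
    rw [this, S_sub, S_d23 h2 (fun i => D i x), S_swap23 h2 (fun i j k => D i (E j (D k x)))]
    simp
  simp only [LinearMap.sub_apply, map_sub, S_sub]
  rw [a4, a3, a2, a1]
  module

variable (v : V) (hv : ∀ i, D i v = 0)
include hv

theorem D_omega (k : Fin n) : D k (S t (fun a b c => E a (E b (E c v)))) =
    (3 : ℝ) • ∑ a, ∑ b, t k a b • E a (E b v) := by
  have e : S t (fun a b c => dl k a • E b (E c v)) = ∑ a, ∑ b, t k a b • E a (E b v) := by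
    simp [S, dl, Finset.sum_ite_irrel, ite_smul, smul_ite]
  have e2 : S t (fun a b c => dl k b • E a (E c v)) = - S t (fun a b c => dl k a • E b (E c v)) :=
    S_swap12 h1 (fun a b c => dl k a • E b (E c v))
  have e3 : S t (fun a b c => dl k c • E a (E b v)) = - S t (fun a b c => dl k b • E a (E c v)) :=
    S_swap23 h2 (fun a b c => dl k b • E a (E c v))
  rw [map_S]
  simp only [hDE, hv, map_sub, map_smul, map_zero, sub_zero, S_sub]
  rw [e3, e2, e]
  module

theorem DD_omega (j k : Fin n) : D j (D k (S t (fun a b c => E a (E b (E c v))))) =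
    (6 : ℝ) • ∑ a, t k j a • E a v := by
  rw [D_omega h1 h2 E D hDE v hv]
  have e : ∑ a, ∑ b, t k a b • dl j b • E a v = - ∑ a, t k j a • E a v := by
    rw [← Finset.sum_neg_distrib]
    refine Finset.sum_congr rfl fun a _ => ?_
    rw [h2 k j a]
    simp [dl, ite_smul, smul_ite]
  have e' : ∑ a, ∑ b, t k a b • dl j a • E b v = ∑ a, t k j a • E a v := by
    simp [dl, Finset.sum_ite_irrel, ite_smul, smul_ite]
  simp only [hDE, hv, map_sub, map_smul, map_zero, sub_zero, map_sum, smul_sub,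
    Finset.sum_sub_distrib]
  rw [e, e']
  module

theorem DDD_omega (i j k : Fin n) : D i (D j (D k (S t (fun a b c => E a (E b (E c v)))))) =
    (-6 * t i j k : ℝ) • v := by
  rw [DD_omega h1 h2 E D hDE v hv]
  have : t k j i = - t i j k := by rw [h1 k j i, h2 j k i, h1 j i k]; ring
  simp [hDE, hv, dl, this, ite_smul, smul_ite, smul_smul]

theorem square_formula (hEE : ∀ i j x, E i (E j x) = - E j (E i x)) :
    S t (fun i j k => (E i - D i) ((E j - D j) ((E k - D k)
      (S t (fun a b c => (E a - D a) ((E b - D b) ((E c - D c) v))))))) =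
      S t (fun i j k => E i (E j (E k (S t (fun a b c => E a (E b (E c v)))))))
      - (9 : ℝ) • S t (fun i j k => E i (E j (∑ a, ∑ b, t k a b • E a (E b v))))
      + (6 * ∑ i, ∑ j, ∑ k, (t i j k)^2) • v := by
  have ω : S t (fun a b c => (E a - D a) ((E b - D b) ((E c - D c) v))) =
      S t (fun a b c => E a (E b (E c v))) := by
    rw [S_LLL h1 h2 E D hDE]
    simp [hv, S]
  have z : S t (fun i j k => E i (D j (D k (S t (fun a b c => E a (E b (E c v))))))) = 0 := by
    simp only [DD_omega h1 h2 E D hDE v hv, map_smul, S_smul]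
    refine smul_eq_zero_of_right _ ?_
    have key : S t (fun i j k => E i (∑ a, t k j a • E a v)) =
        ∑ i, ∑ a, (∑ j, ∑ k, t i j k * t k j a) • E i (E a v) := by
      simp only [S, map_sum, map_smul, Finset.smul_sum, Finset.sum_smul, smul_smul]
      refine Finset.sum_congr rfl fun i _ => ?_
      conv_rhs => rw [Finset.sum_comm]
      refine Finset.sum_congr rfl fun j _ => ?_
      rw [Finset.sum_comm]
    have sy : ∀ i a, (∑ j, ∑ k, t i j k * t k j a) = ∑ j, ∑ k, t a j k * t k j i := by
      intro i a
      refine Finset.sum_congr rfl fun j _ => Finset.sum_congr rfl fun k _ => ?_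
      have r : ∀ i j k, t k j i = - t i j k := fun i j k => by
        rw [h1 k j i, h2 j k i, h1 j i k]; ring
      rw [r a j k, r i j k]; ring
    rw [key]
    refine eq_zero_of_self_eq_neg ?_
    conv_rhs => rw [Finset.sum_comm, ← Finset.sum_neg_distrib]
    refine Finset.sum_congr rfl fun i _ => ?_
    rw [← Finset.sum_neg_distrib]
    refine Finset.sum_congr rfl fun a _ => ?_
    rw [hEE a i, smul_neg, neg_neg, sy]
  rw [ω, S_LLL h1 h2 E D hDE, z]
  have d3 : S t (fun i j k => D i (D j (D k (S t (fun a b c => E a (E b (E c v))))))) =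
      (-6 * ∑ i, ∑ j, ∑ k, (t i j k)^2) • v := by
    simp only [DDD_omega h1 h2 E D hDE v hv]
    simp only [S, Finset.mul_sum, Finset.sum_smul, smul_smul]
    refine Finset.sum_congr rfl fun i _ => Finset.sum_congr rfl fun j _ =>
      Finset.sum_congr rfl fun k _ => ?_
    congr 1; ring
  rw [d3]
  simp only [D_omega h1 h2 E D hDE v hv, map_smul, S_smul]
  module

end TriForm

open TriForm in
theorem equivExterior_ι_mul' (n : ℕ) (i : Fin n) (x : CliffordAlgebra (QnegE n)) :
    CliffordAlgebra.equivExterior (QnegE n) (ι (QnegE n) (Pi.single i 1) * x) =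
      (LinearMap.mulLeft ℝ (ExteriorAlgebra.ι ℝ (Pi.single i 1 : Fin n → ℝ))
        - contractLeft (Q := (0 : QuadraticForm ℝ (Fin n → ℝ))) (LinearMap.proj i))
        (CliffordAlgebra.equivExterior (QnegE n) x) := by
  have hB : QuadraticMap.associated (R := ℝ) (-(QnegE n)) (Pi.single i 1) =
      (LinearMap.proj i : (Fin n → ℝ) →ₗ[ℝ] ℝ) := by
    refine LinearMap.ext fun y => ?_
    have gen : ∀ x y : Fin n → ℝ,
        QuadraticMap.associated (R := ℝ) (-(QnegE n)) x y = ∑ j, x j * y j := by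
      intro x y
      have h2 := QuadraticMap.two_nsmul_associated ℝ (-(QnegE n))
      have h3 := congrArg (fun B => B x y) h2
      simp only [QuadraticMap.polarBilin_apply_apply, QuadraticMap.polar, LinearMap.smul_apply,
        nsmul_eq_mul] at h3
      have h4 : ∀ z, (-(QnegE n)) z = ∑ j, z j * z j := fun z => by
        simp [QnegE, QuadraticMap.weightedSumSquares_apply]
      rw [h4, h4, h4] at h3
      have h5 : ∑ j, (x + y) j * (x + y) j = ∑ j, x j * x j + ∑ j, y j * y j
          + 2 * ∑ j, x j * y j := by
        rw [Finset.mul_sum, ← Finset.sum_add_distrib, ← Finset.sum_add_distrib]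
        refine Finset.sum_congr rfl fun j _ => ?_
        simp only [Pi.add_apply]
        ring
      push_cast at h3
      linarith
    rw [gen]
    simp [Pi.single_apply]
  have := changeForm_ι_mul (changeForm.associated_neg_proof (Q := QnegE n)) (Pi.single i 1) x
  rw [hB] at this
  exact this

theorem ext_proj_same {n i : ℕ} {x : ExteriorAlgebra ℝ (Fin n → ℝ)}
    (hx : x ∈ ⋀[ℝ]^i (Fin n → ℝ)) :
    GradedAlgebra.proj (fun i : ℕ => ⋀[ℝ]^i (Fin n → ℝ)) i x = x :=
  DirectSum.decompose_of_mem_same (fun i : ℕ => ⋀[ℝ]^i (Fin n → ℝ)) hx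

theorem ext_proj_ne {n i j : ℕ} {x : ExteriorAlgebra ℝ (Fin n → ℝ)}
    (hx : x ∈ ⋀[ℝ]^i (Fin n → ℝ)) (hij : i ≠ j) :
    GradedAlgebra.proj (fun i : ℕ => ⋀[ℝ]^i (Fin n → ℝ)) j x = 0 :=
  DirectSum.decompose_of_mem_ne (fun i : ℕ => ⋀[ℝ]^i (Fin n → ℝ)) hx hij

theorem S_eee_sq {n : ℕ} (t : Fin n → Fin n → Fin n → ℝ) (e : Fin n → ExteriorAlgebra ℝ (Fin n → ℝ))
    (he : ∀ i j, e i * e j = - (e j * e i)) :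
    TriForm.S t (fun i j k => e i * (e j * (e k * TriForm.S t
      (fun a b c => e a * (e b * (e c * 1)))))) = 0 := by
  set w := TriForm.S t (fun a b c => e a * (e b * (e c * 1))) with hw
  have c : ∀ i, e i * w = - (w * e i) := by
    intro i
    simp only [hw, TriForm.S, Finset.mul_sum, Finset.sum_mul, ← Finset.sum_neg_distrib]
    refine Finset.sum_congr rfl fun a _ => Finset.sum_congr rfl fun b _ =>
      Finset.sum_congr rfl fun c _ => ?_
    rw [mul_smul_comm, smul_mul_assoc, ← smul_neg]
    congr 1
    simp only [mul_one, mul_assoc]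
    have hx : ∀ a x, e i * (e a * x) = - (e a * (e i * x)) := fun a x => by
      rw [← mul_assoc, he, neg_mul, mul_assoc]
    rw [hx, hx, he i c]
    simp
  have l : TriForm.S t (fun i j k => e i * (e j * (e k * w))) = w * w := by
    conv_rhs => enter [1]; rw [hw]
    simp only [TriForm.S, Finset.sum_mul, mul_assoc, smul_mul_assoc, one_mul]
  have r : TriForm.S t (fun i j k => e i * (e j * (e k * w))) = - (w * w) := by
    conv_rhs => enter [1, 2]; rw [hw]
    simp only [c, mul_neg, ← mul_assoc, TriForm.S, Finset.mul_sum, ← Finset.sum_neg_distrib,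
      neg_mul, mul_smul_comm]
    simp [mul_assoc]
  rw [← l] at r
  exact TriForm.eq_zero_of_self_eq_neg r

/-- for a 3-form T in dimension n ≥ 5, the Clifford square T² has no
components of degree 2 and 6; its scalar part is ‖T‖² = (1/6)Σ_{i,j}‖T(eᵢ,eⱼ)‖² and
its degree-4 part is −2σ_T, where σ_T = (1/2)Σ_k (e_k ⌟ T) ∧ (e_k ⌟ T).

The 3-form is given by its alternating coefficients `t i j k` (so that
T = (1/6)Σ t i j k eᵢeⱼe_k, e_k ⌟ T = (1/2)Σ_{a,b} t k a b e_a∧e_b, and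
‖T(eᵢ,eⱼ)‖² = Σ_k (t i j k)²); the degree components are read off through the
canonical linear isomorphism `CliffordAlgebra.equivExterior` with the graded
exterior algebra, wedge products being products in the exterior algebra. -/
theorem stmt_1 (n : ℕ) (hn : 5 ≤ n)
    (t : Fin n → Fin n → Fin n → ℝ)
    (halt1 : ∀ i j k, t i j k = - t j i k)
    (halt2 : ∀ i j k, t i j k = - t i k j)
    (T : CliffordAlgebra (QnegE n))
    (hT : T = (1/6 : ℝ) • ∑ i, ∑ j, ∑ k, t i j k •
      (ι (QnegE n) (Pi.single i 1) * ι (QnegE n) (Pi.single j 1) *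
        ι (QnegE n) (Pi.single k 1)))
    (σT : ExteriorAlgebra ℝ (Fin n → ℝ))
    (hσT : σT = (1/2 : ℝ) • ∑ k,
      (((1/2 : ℝ) • ∑ a, ∑ b, t k a b •
        (ExteriorAlgebra.ι ℝ (Pi.single a 1) * ExteriorAlgebra.ι ℝ (Pi.single b 1))) *
       ((1/2 : ℝ) • ∑ a, ∑ b, t k a b •
        (ExteriorAlgebra.ι ℝ (Pi.single a 1) * ExteriorAlgebra.ι ℝ (Pi.single b 1))))) :
    GradedAlgebra.proj (fun i : ℕ => ⋀[ℝ]^i (Fin n → ℝ)) 2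
        (CliffordAlgebra.equivExterior (QnegE n) (T * T)) = 0 ∧
    GradedAlgebra.proj (fun i : ℕ => ⋀[ℝ]^i (Fin n → ℝ)) 6
        (CliffordAlgebra.equivExterior (QnegE n) (T * T)) = 0 ∧
    GradedAlgebra.proj (fun i : ℕ => ⋀[ℝ]^i (Fin n → ℝ)) 0
        (CliffordAlgebra.equivExterior (QnegE n) (T * T))
      = algebraMap ℝ (ExteriorAlgebra ℝ (Fin n → ℝ))
          ((1/6) * ∑ i, ∑ j, ∑ k, (t i j k)^2) ∧
    GradedAlgebra.proj (fun i : ℕ => ⋀[ℝ]^i (Fin n → ℝ)) 4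
        (CliffordAlgebra.equivExterior (QnegE n) (T * T))
      = (-2 : ℝ) • σT := by
  set e : Fin n → ExteriorAlgebra ℝ (Fin n → ℝ) :=
    fun i => ExteriorAlgebra.ι ℝ (Pi.single i 1 : Fin n → ℝ) with he
  set E : Fin n → ExteriorAlgebra ℝ (Fin n → ℝ) →ₗ[ℝ] ExteriorAlgebra ℝ (Fin n → ℝ) :=
    fun i => LinearMap.mulLeft ℝ (e i) with hE
  set D : Fin n → ExteriorAlgebra ℝ (Fin n → ℝ) →ₗ[ℝ] ExteriorAlgebra ℝ (Fin n → ℝ) :=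
    fun i => contractLeft (Q := (0 : QuadraticForm ℝ (Fin n → ℝ))) (LinearMap.proj i) with hD
  have hee : ∀ i j, e i * e j = - (e j * e i) := fun i j =>
    eq_neg_of_add_eq_zero_left (ExteriorAlgebra.ι_add_mul_swap _ _)
  have hEE : ∀ i j x, E i (E j x) = - E j (E i x) := by
    intro i j x
    simp only [hE, LinearMap.mulLeft_apply, ← mul_assoc]
    rw [hee i j, neg_mul]
  have hDE : ∀ i j x, D i (E j x) = TriForm.dl i j • x - E j (D i x) := by
    intro i j x
    simp only [hE, hD, LinearMap.mulLeft_apply, he]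
    refine (contractLeft_ι_mul _ _ _).trans ?_
    simp [TriForm.dl, Pi.single_apply]
  have hv : ∀ i, D i 1 = 0 := fun i => contractLeft_one _ _
  have step : ∀ x, CliffordAlgebra.equivExterior (QnegE n) (T * x) = (1/6 : ℝ) •
      TriForm.S t (fun i j k => (E i - D i) ((E j - D j) ((E k - D k)
        (CliffordAlgebra.equivExterior (QnegE n) x)))) := by
    intro x
    rw [hT]
    simp only [smul_mul_assoc, Finset.sum_mul, map_smul, map_sum, mul_assoc,
      equivExterior_ι_mul', TriForm.S]
    rfl
  have one : CliffordAlgebra.equivExterior (QnegE n) 1 = 1 :=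
    changeForm_one (changeForm.associated_neg_proof (Q := QnegE n))
  have main : CliffordAlgebra.equivExterior (QnegE n) (T * T) = (-2 : ℝ) • σT +
      algebraMap ℝ (ExteriorAlgebra ℝ (Fin n → ℝ)) ((1/6) * ∑ i, ∑ j, ∑ k, (t i j k)^2) := by
    have hTT := step (T * 1)
    rw [step 1, one] at hTT
    simp only [map_smul, TriForm.S_smul] at hTT
    rw [TriForm.square_formula halt1 halt2 E D hDE 1 hv hEE] at hTT
    have z := S_eee_sq t e hee
    have s4 : TriForm.S t (fun i j k => E i (E j (∑ a, ∑ b, t k a b • E a (E b 1)))) =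
        (8 : ℝ) • σT := by
      have hX : TriForm.S t (fun i j k => E i (E j (∑ a, ∑ b, t k a b • E a (E b 1)))) =
          ∑ k, (∑ a, ∑ b, t k a b • (e a * e b)) * (∑ a, ∑ b, t k a b • (e a * e b)) := by
        have cyc : ∀ i j k, t i j k = t k i j := fun i j k => by
          rw [halt2 i j k, halt1 i k j, neg_neg]
        simp only [hE, LinearMap.mulLeft_apply, mul_one, TriForm.S]
        simp only [← mul_assoc, ← smul_mul_assoc]
        have inner : ∀ i, ∑ j, ∑ k, t i j k • (e i * e j) * (∑ a, ∑ b, t k a b • e a * e b) =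
            ∑ k, ∑ j, t i j k • (e i * e j) * (∑ a, ∑ b, t k a b • e a * e b) :=
          fun i => Finset.sum_comm
        simp only [smul_mul_assoc] at inner ⊢
        simp only [inner]
        rw [Finset.sum_comm]
        refine Finset.sum_congr rfl fun k _ => ?_
        rw [Finset.sum_mul]
        refine Finset.sum_congr rfl fun i _ => ?_
        rw [Finset.sum_mul]
        refine Finset.sum_congr rfl fun j _ => ?_
        rw [cyc i j k, smul_mul_assoc]
      rw [hX, hσT]
      simp only [smul_mul_assoc, mul_smul_comm, ← Finset.smul_sum]
      module
    simp only [hE, LinearMap.mulLeft_apply] at hTT s4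
    rw [z, s4, mul_one] at hTT
    rw [hTT, Algebra.algebraMap_eq_smul_one]
    module
  have m4 : (-2 : ℝ) • σT ∈ ⋀[ℝ]^4 (Fin n → ℝ) := by
    have hm : ∀ i, e i ∈ LinearMap.range (ExteriorAlgebra.ι ℝ : (Fin n → ℝ) →ₗ[ℝ] _) :=
      fun i => ⟨_, rfl⟩
    have m2 : ∀ k, ((1/2 : ℝ) • ∑ a, ∑ b, t k a b • (e a * e b)) ∈ ⋀[ℝ]^2 (Fin n → ℝ) := by
      intro k
      refine Submodule.smul_mem _ _ (Submodule.sum_mem _ fun a _ => Submodule.sum_mem _ fun b _ =>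
        Submodule.smul_mem _ _ ?_)
      rw [exteriorPower, pow_two]
      exact Submodule.mul_mem_mul (hm a) (hm b)
    rw [hσT]
    refine Submodule.smul_mem _ _ (Submodule.smul_mem _ _ (Submodule.sum_mem _ fun k _ => ?_))
    rw [exteriorPower, show 4 = 2 + 2 from rfl, pow_add]
    exact Submodule.mul_mem_mul (m2 k) (m2 k)
  have m0 : ∀ r : ℝ, algebraMap ℝ (ExteriorAlgebra ℝ (Fin n → ℝ)) r ∈ ⋀[ℝ]^0 (Fin n → ℝ) := by
    intro r
    rw [exteriorPower, pow_zero]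
    exact Submodule.mem_one.2 ⟨r, rfl⟩
  rw [main]
  simp only [map_add]
  refine ⟨?_, ?_, ?_, ?_⟩
  · rw [ext_proj_ne m4 (by norm_num),
      ext_proj_ne (m0 _) (by norm_num), add_zero]
  · rw [ext_proj_ne m4 (by norm_num),
      ext_proj_ne (m0 _) (by norm_num), add_zero]
  · rw [ext_proj_ne m4 (by norm_num),
      ext_proj_same (m0 _), zero_add]
  · rw [ext_proj_same m4,
      ext_proj_ne (m0 _) (by norm_num), add_zero]
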